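/- Let μ and ν be compactly supported Borel probability measures on ℝ, neither of which is a point mass. Let ω₁, ω₂ : ℂ⁺ → ℂ⁺ be analytic with lim_{y→+∞} ω_j(iy)/(iy) = 1 for j = 1, 2 and ω₁(z) + ω₂(z) − z = F_μ(ω₁(z)) = F_ν(ω₂(z)) for all z ∈ ℂ⁺, and let σ be a Borel probability measure on ℝ such that G_σ(z) = 1/(ω₁(z) + ω₂(z) − z) for all z ∈ ℂ⁺ (σ is the free additive convolution μ⊞ν). Then for every x ∈ ℝ∖supp(σ): ω₁ and ω₂ extend meromorphically to a neighborhood of x, taking values in ℝ∪{∞} on a real neighborhood of x; ω₁(x) = h_ν(ω₂(x)) + x lies in (ℝ∪{∞})∖supp(μ) and ω₂(x) = h_μ(ω₁(x)) + x lies in (ℝ∪{∞})∖supp(ν); moreover, if ω₁(x) = ∞ then ω₂ is analytic at x with ω₂(x) = x − ∫ t dμ(t) ∈ ℝ, and if ω₂(x) = ∞ then ω₁ is analytic at x with ω₁(x) = x − ∫ t dν(t) ∈ ℝ. -/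

import Mathlib

open MeasureTheory Filter Metric

/-- The Cauchy–Stieltjes transform `G_μ(z) = ∫ 1/(z-t) dμ(t)` of a measure on `ℝ`. -/
noncomputable def cauchyT (μ : Measure ℝ) (z : ℂ) : ℂ :=
  ∫ t, (z - (t : ℂ))⁻¹ ∂μ

/-- The (topological) support of a Borel measure on `ℝ`. -/
def msupp (μ : Measure ℝ) : Set ℝ :=
  {x : ℝ | ∀ r : ℝ, 0 < r → 0 < μ (Metric.ball x r)}

section

open Complex Topology ComplexConjugate

/-- A continuous function on a disc which is holomorphic off the real axis is holomorphic. -/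
theorem differentiableOn_ball_of_differentiableAt_off_real {f : ℂ → ℂ} {c : ℂ} {r : ℝ}
    (hc : ContinuousOn f (ball c r))
    (hd : ∀ z ∈ ball c r, z.im ≠ 0 → DifferentiableAt ℂ f z) :
    DifferentiableOn ℂ f (ball c r) := by
  have one_side : ∀ z w : ℂ, Rectangle z w ⊆ ball c r →
      (∀ y ∈ Set.Ioo (min z.im w.im) (max z.im w.im), y ≠ 0) →
      wedgeIntegral z w f + wedgeIntegral w z f = 0 := by
    intro z w hzw hy
    rw [wedgeIntegral_add_wedgeIntegral_eq]
    refine integral_boundary_rect_eq_zero_of_differentiable_on_off_countable f z w ∅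
      Set.countable_empty (hc.mono hzw) fun p hp => ?_
    rw [Set.sdiff_empty, mem_reProdIm] at hp
    refine hd p (hzw ?_) (hy _ hp.2)
    exact mem_reProdIm.2 ⟨Set.Ioo_subset_Icc_self hp.1, Set.Ioo_subset_Icc_self hp.2⟩
  refine (IsConservativeOn.isExactOn_ball hc fun z w hzw => ?_).differentiableOn isOpen_ball
  rw [eq_neg_iff_add_eq_zero]
  by_cases h0 : (0 : ℝ) ∈ Set.uIcc z.im w.im
  · have hsub₁ : Set.uIcc z.im 0 ⊆ Set.uIcc z.im w.im := Set.uIcc_subset_uIcc_left h0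
    have hsub₂ : Set.uIcc 0 w.im ⊆ Set.uIcc z.im w.im := Set.uIcc_subset_uIcc_right h0
    have h₁ := one_side z (w.re : ℂ) (fun p hp => hzw ?_) ?_
    have h₂ := one_side (z.re : ℂ) w (fun p hp => hzw ?_) ?_
    · rw [wedgeIntegral_add_wedgeIntegral_eq] at h₁ h₂ ⊢
      have key : ∀ a ∈ Set.uIcc z.re w.re,
          (∫ y in z.im..w.im, f (a + y * I)) =
            (∫ y in z.im..0, f (a + y * I)) + ∫ y in (0 : ℝ)..w.im, f (a + y * I) := by
        intro a ha
        have hcont : ContinuousOn (fun y : ℝ => f (a + y * I)) (Set.uIcc z.im w.im) := by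
          refine hc.comp (by fun_prop) fun y hy => hzw ?_
          exact mem_reProdIm.2 ⟨by simpa using ha, by simpa using hy⟩
        exact (intervalIntegral.integral_add_adjacent_intervals
          (hcont.mono hsub₁).intervalIntegrable (hcont.mono hsub₂).intervalIntegrable).symm
      rw [key _ Set.left_mem_uIcc, key _ Set.right_mem_uIcc]
      simp only [ofReal_re, ofReal_im, smul_eq_mul] at h₁ h₂ ⊢
      linear_combination h₁ + h₂
    · have := mem_reProdIm.1 hp
      simp only [ofReal_re, ofReal_im] at this
      exact mem_reProdIm.2 ⟨this.1, hsub₂ this.2⟩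
    · intro y hy h
      simp only [ofReal_im, h, Set.mem_Ioo] at hy
      rcases le_total 0 w.im with h' | h' <;> simp [h'] at hy
    · have := mem_reProdIm.1 hp
      simp only [ofReal_re, ofReal_im] at this
      exact mem_reProdIm.2 ⟨this.1, hsub₁ this.2⟩
    · intro y hy h
      simp only [ofReal_im, h, Set.mem_Ioo] at hy
      rcases le_total 0 z.im with h' | h' <;> simp [h'] at hy
  · exact one_side z w hzw fun y hy h => h0 (h ▸ Set.Ioo_subset_Icc_self hy)

/-- **Schwarz reflection principle** on a disc centred on the real axis. -/
theorem exists_schwarz_reflection {g : ℂ → ℂ} {x r : ℝ} (hg : Continuous g)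
    (hd : DifferentiableOn ℂ g (ball (x : ℂ) r ∩ {z | 0 < z.im}))
    (hreal : ∀ z ∈ ball (x : ℂ) r, z.im = 0 → (g z).im = 0) :
    ∃ R : ℂ → ℂ, DifferentiableOn ℂ R (ball (x : ℂ) r) ∧
      (∀ z ∈ ball (x : ℂ) r, 0 < z.im → R z = g z) ∧
      ∀ z ∈ ball (x : ℂ) r, R (conj z) = conj (R z) := by
  have hconj : ∀ z ∈ ball (x : ℂ) r, conj z ∈ ball (x : ℂ) r := by
    intro z hz
    rw [mem_ball, Complex.dist_eq] at hz ⊢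
    rwa [← Complex.norm_conj, map_sub, conj_conj, conj_ofReal]
  have hopen : IsOpen (ball (x : ℂ) r ∩ {z | 0 < z.im}) :=
    isOpen_ball.inter (isOpen_lt continuous_const continuous_im)
  let R : ℂ → ℂ := fun z => if 0 ≤ z.im then g z else conj (g (conj z))
  refine ⟨R, differentiableOn_ball_of_differentiableAt_off_real ?_ ?_, ?_, ?_⟩
  · refine ContinuousOn.if ?_ hg.continuousOn (by fun_prop)
    rintro z ⟨hz, hz'⟩
    have h0 : z.im = 0 := by
      have := frontier_le_subset_eq continuous_const continuous_im hz'
      exact this.symm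
    have h1 : conj z = z := conj_eq_iff_im.2 h0
    rw [h1, conj_eq_iff_im.2 (hreal z hz h0)]
  · intro z hz hne
    rcases lt_or_gt_of_ne hne with h | h
    · have hz' : conj z ∈ ball (x : ℂ) r ∩ {z | 0 < z.im} := ⟨hconj z hz, by simpa using h⟩
      have h1 : DifferentiableAt ℂ (conj ∘ g ∘ conj) z :=
        differentiableAt_conj_conj_iff.2 (hd.differentiableAt (hopen.mem_nhds hz'))
      refine h1.congr_of_eventuallyEq ?_
      filter_upwards [(isOpen_lt continuous_im continuous_const).mem_nhds h] with w hw
      have hw' : ¬ 0 ≤ w.im := not_le.2 hw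
      simp [R, hw']
    · have h1 := hd.differentiableAt (hopen.mem_nhds ⟨hz, h⟩)
      refine h1.congr_of_eventuallyEq ?_
      filter_upwards [(isOpen_lt continuous_const continuous_im).mem_nhds h] with w hw
      have hw' : 0 ≤ w.im := le_of_lt hw
      simp [R, hw']
  · intro z _ h
    simp [R, h.le]
  · intro z hz
    rcases lt_trichotomy z.im 0 with h | h | h
    · have h' : ¬ 0 ≤ z.im := not_le.2 h
      simp [R, h', h.le]
    · have h1 : conj z = z := conj_eq_iff_im.2 h
      rw [h1, eq_comm, conj_eq_iff_im]
      simpa [R, h] using hreal z hz h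
    · have h' : ¬ z.im ≤ 0 := not_le.2 h
      simp [R, h', h.le]

/-- Derivative estimate for holomorphic self-maps of the upper half-plane. -/
theorem norm_deriv_le_of_mapsTo_upperHalf {ω : ℂ → ℂ}
    (ha : DifferentiableOn ℂ ω {z : ℂ | 0 < z.im}) (hm : ∀ z : ℂ, 0 < z.im → 0 < (ω z).im)
    {z : ℂ} (hz : 0 < z.im) : ‖deriv ω z‖ ≤ 2 * ((ω z).im / z.im) := by
  set w := ω z with hw
  have hwpos : 0 < w.im := hm z hz
  have hball : ∀ p ∈ ball z z.im, 0 < p.im := by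
    intro p hp
    rw [mem_ball, Complex.dist_eq] at hp
    have := (abs_le.1 ((abs_im_le_norm (p - z)))).1
    rw [sub_im] at this
    linarith
  have hden : ∀ p : ℂ, 0 < p.im → ω p - conj w ≠ 0 := by
    intro p hp h
    have := congrArg Complex.im h
    simp at this
    linarith [hm p hp]
  let φ : ℂ → ℂ := fun p => (ω p - w) / (ω p - conj w)
  have hdω : HasDerivAt ω (deriv ω z) z :=
    (ha.differentiableAt ((isOpen_lt continuous_const continuous_im).mem_nhds hz)).hasDerivAt
  have hφd : DifferentiableOn ℂ φ (ball z z.im) := by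
    have h1 : DifferentiableOn ℂ ω (ball z z.im) := ha.mono hball
    exact (h1.sub_const _).div (h1.sub_const _) fun p hp => hden p (hball p hp)
  have hφz : φ z = 0 := by simp [φ, hw]
  have hmaps : Set.MapsTo φ (ball z z.im) (ball (φ z) 1) := by
    intro p hp
    have hp' := hm p (hball p hp)
    rw [hφz, mem_ball_zero_iff, norm_div, div_lt_one (norm_pos_iff.2 (hden p (hball p hp)))]
    rw [← sq_lt_sq₀ (norm_nonneg _) (norm_nonneg _), ← normSq_eq_norm_sq, ← normSq_eq_norm_sq,
      normSq_apply, normSq_apply]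
    simp
    nlinarith
  have hder := norm_deriv_le_div_of_mapsTo_ball hφd (hmaps.mono_right ball_subset_closedBall) hz
  have hφ' : HasDerivAt φ (deriv ω z / (w - conj w)) z := by
    have h2 := (hdω.sub_const w).div (hdω.sub_const (conj w)) (hden z hz)
    have h3 : w - conj w ≠ 0 := hden z hz
    refine h2.congr_deriv ?_
    rw [← hw]
    field_simp
    ring
  rw [hφ'.deriv, norm_div, sub_conj, norm_mul, norm_I, mul_one, norm_real, Real.norm_eq_abs,
    abs_of_pos (by positivity), div_le_iff₀ (by positivity)] at hder
  calc ‖deriv ω z‖ ≤ 1 / z.im * (2 * w.im) := hder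
    _ = _ := by ring

/-- On a segment from `i r / 2` into the closed upper half-disc of radius `r`, the norm is bounded
below by a constant multiple of the norm of the endpoint. -/
theorem norm_sq_le_on_segment {r : ℝ} (hr : 0 < r) {ζ : ℂ} (hζ : ‖ζ‖ ≤ r) (him : 0 ≤ ζ.im)
    {p : ℂ} (hp : p ∈ segment ℝ ((r / 2 : ℝ) * I) ζ) : ‖ζ‖ ^ 2 ≤ 5 * ‖p‖ ^ 2 := by
  obtain ⟨a, b, ha, hb, hab, rfl⟩ := hp
  have h1 : ‖ζ‖ ^ 2 ≤ r ^ 2 := by gcongr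
  rw [← normSq_eq_norm_sq, normSq_apply] at h1 ⊢
  rw [← normSq_eq_norm_sq, normSq_apply]
  simp
  have h2 : a = 1 - b := by linarith
  have h3 : 0 ≤ a * b * r * ζ.im := by positivity
  have h4 : a ^ 2 * (ζ.re * ζ.re + ζ.im * ζ.im) ≤ a ^ 2 * r ^ 2 := by gcongr
  have h5 : 1 ≤ 5 * b ^ 2 + 5 / 4 * a ^ 2 := by subst h2; nlinarith [sq_nonneg (5 * b - 1)]
  have h6 : 0 ≤ ζ.re * ζ.re + ζ.im * ζ.im := add_nonneg (mul_self_nonneg _) (mul_self_nonneg _)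
  nlinarith [mul_le_mul_of_nonneg_right h5 h6]

/-- A holomorphic self-map of the upper half-plane whose imaginary part is
`O(Im z / |z - x|²)` near a real point `x` continues meromorphically across `x`. -/
theorem exists_meromorphic_extension {ω : ℂ → ℂ}
    (ha : DifferentiableOn ℂ ω {z : ℂ | 0 < z.im}) (hm : ∀ z : ℂ, 0 < z.im → 0 < (ω z).im)
    {x r C : ℝ} (hr : 0 < r)
    (hC : ∀ z ∈ ball (x : ℂ) r, 0 < z.im → (ω z).im ≤ C * z.im / ‖z - x‖ ^ 2) :
    ∃ Ω : ℂ → ℂ, (∀ z ∈ ball (x : ℂ) r, z ≠ x → AnalyticAt ℂ Ω z) ∧ MeromorphicNFAt Ω (x : ℂ) ∧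
      (∀ z ∈ ball (x : ℂ) r, 0 < z.im → Ω z = ω z) ∧
      ∀ z ∈ ball (x : ℂ) r, z ≠ x → Ω (conj z) = conj (Ω z) := by
  set U : Set ℂ := ball (x : ℂ) r ∩ {z | 0 < z.im} with hU
  have hUo : IsOpen U := isOpen_ball.inter (isOpen_lt continuous_const continuous_im)
  have hUc : Convex ℝ U := (convex_ball _ _).inter (convex_halfSpace_im_gt 0)
  have hne : ∀ z ∈ U, 0 < ‖z - x‖ := by
    rintro z ⟨-, hz⟩
    refine norm_pos_iff.2 fun h => ?_
    have hz' : 0 < z.im := hz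
    rw [sub_eq_zero.1 h, ofReal_im] at hz'
    exact lt_irrefl _ hz'
  have hlt : ∀ z ∈ U, ‖z - x‖ < r := fun z hz => by
    simpa [Complex.dist_eq] using hz.1
  have hCpos : 0 ≤ C := by
    have hz : (x + (r / 2 : ℝ) * I : ℂ) ∈ U := by
      constructor
      · simp [abs_of_pos hr, hr]
      · simp [hr]
    have h1 := (hm _ hz.2).le.trans (hC _ hz.1 hz.2)
    have h2 := hne _ hz
    have h3 : 0 < (x + (r / 2 : ℝ) * I : ℂ).im := hz.2
    by_contra h
    have : C * (x + (r / 2 : ℝ) * I : ℂ).im / ‖(x + (r / 2 : ℝ) * I : ℂ) - x‖ ^ 2 < 0 :=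
      div_neg_of_neg_of_pos (mul_neg_of_neg_of_pos (not_le.1 h) h3) (by positivity)
    linarith
  have hda : ∀ z ∈ U, HasDerivAt ω (deriv ω z) z := fun z hz =>
    (ha.differentiableAt ((isOpen_lt continuous_const continuous_im).mem_nhds hz.2)).hasDerivAt
  have hder : ∀ z ∈ U, ‖deriv ω z‖ ≤ 2 * C / ‖z - x‖ ^ 2 := by
    intro z hz
    have hz2 : 0 < z.im := hz.2
    refine (norm_deriv_le_of_mapsTo_upperHalf ha hm hz.2).trans ?_
    have h1 := hC z hz.1 hz.2
    calc 2 * ((ω z).im / z.im) ≤ 2 * ((C * z.im / ‖z - x‖ ^ 2) / z.im) := by gcongr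
      _ = _ := by field_simp
  set z₀ : ℂ := x + (r / 2 : ℝ) * I with hz₀
  have hz₀U : z₀ ∈ U := by
    constructor
    · simp [hz₀, abs_of_pos hr, hr]
    · simp [hz₀, hr]
  obtain ⟨M, hM0, hM⟩ : ∃ M : ℝ, 0 ≤ M ∧ ∀ z ∈ U, ‖ω z‖ ≤ M / ‖z - x‖ ^ 2 := by
    refine ⟨‖ω z₀‖ * r ^ 2 + 10 * C * (2 * r), by positivity, fun z hz => ?_⟩
    have hzp := hne z hz
    have hzr := hlt z hz
    have hseg : ∀ p ∈ segment ℝ z₀ z, ‖deriv ω p‖ ≤ 10 * C / ‖z - x‖ ^ 2 := by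
      intro p hp
      have hpU := hUc.segment_subset hz₀U hz hp
      refine (hder p hpU).trans ?_
      have hp' : p - x ∈ segment ℝ ((r / 2 : ℝ) * I : ℂ) (z - x) := by
        have := (mem_segment_translate ℝ (-(x : ℂ)) (x := p) (b := z₀) (c := z)).2 hp
        have e : -(x : ℂ) + z₀ = (r / 2 : ℝ) * I := by rw [hz₀]; ring
        rw [e] at this
        simpa [sub_eq_neg_add] using this
      have h5 := norm_sq_le_on_segment hr hzr.le
        (by simpa using (show 0 < z.im from hz.2).le) hp'
      have := hne p hpU
      rw [div_le_div_iff₀ (by positivity) (by positivity)]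
      nlinarith
    have h6 := (convex_segment z₀ z).norm_image_sub_le_of_norm_deriv_le (𝕜 := ℂ)
      (fun p hp => (hda p (hUc.segment_subset hz₀U hz hp)).differentiableAt) hseg
      (left_mem_segment ℝ z₀ z) (right_mem_segment ℝ z₀ z)
    have h7 : ‖z - z₀‖ ≤ 2 * r := by
      calc ‖z - z₀‖ = ‖(z - x) - (z₀ - x)‖ := by congr 1; ring
        _ ≤ ‖z - x‖ + ‖z₀ - x‖ := norm_sub_le _ _
        _ ≤ 2 * r := by linarith [hlt z₀ hz₀U]
    have h8 : ‖ω z‖ ≤ ‖ω z₀‖ + 10 * C / ‖z - x‖ ^ 2 * (2 * r) := by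
      have h9 : ‖ω z‖ ≤ ‖ω z₀‖ + ‖ω z - ω z₀‖ := by
        simpa using norm_add_le (ω z₀) (ω z - ω z₀)
      have : 10 * C / ‖z - x‖ ^ 2 * ‖z - z₀‖ ≤ 10 * C / ‖z - x‖ ^ 2 * (2 * r) := by gcongr
      linarith
    refine h8.trans ?_
    rw [add_div]
    have : ‖ω z₀‖ ≤ ‖ω z₀‖ * r ^ 2 / ‖z - x‖ ^ 2 := by
      rw [le_div_iff₀ (by positivity)]
      gcongr
    have e : 10 * C / ‖z - x‖ ^ 2 * (2 * r) = 10 * C * (2 * r) / ‖z - x‖ ^ 2 := by ring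
    linarith
  let q : ℂ → ℂ := fun z => (z - x) ^ 3 * ω z
  have hqd : ∀ z ∈ U, HasDerivAt q (3 * (z - x) ^ 2 * ω z + (z - x) ^ 3 * deriv ω z) z := by
    intro z hz
    have := (((hasDerivAt_id z).sub_const (x : ℂ)).pow 3).mul (hda z hz)
    refine this.congr_deriv ?_
    simp
  have hqb : ∀ z ∈ U, ‖3 * (z - x) ^ 2 * ω z + (z - x) ^ 3 * deriv ω z‖ ≤ 3 * M + r * (2 * C) := by
    intro z hz
    have hzp := hne z hz
    refine (norm_add_le _ _).trans (add_le_add ?_ ?_)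
    · rw [norm_mul, norm_mul, norm_pow]
      have := hM z hz
      rw [le_div_iff₀ (by positivity)] at this
      norm_num
      linarith
    · rw [norm_mul, norm_pow]
      have := hder z hz
      rw [le_div_iff₀ (by positivity)] at this
      calc ‖z - x‖ ^ 3 * ‖deriv ω z‖ = ‖z - x‖ * (‖deriv ω z‖ * ‖z - x‖ ^ 2) := by ring
        _ ≤ r * (2 * C) := mul_le_mul (hlt z hz).le this (by positivity) hr.le
  have hlip : LipschitzOnWith (Real.toNNReal (3 * M + r * (2 * C))) q U := by
    refine hUc.lipschitzOnWith_of_nnnorm_hasDerivWithin_le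
      (fun z hz => (hqd z hz).hasDerivWithinAt) fun z hz => ?_
    rw [← NNReal.coe_le_coe, Real.coe_toNNReal _ (by positivity)]
    exact hqb z hz
  obtain ⟨g, hgl, hgq⟩ := hlip.extend_finite_dimension
  have hgc : Continuous g := hgl.continuous
  have happroach : ∀ y ∈ ball (x : ℂ) r, y.im = 0 →
      ∃ l : Filter ℂ, l.NeBot ∧ l ≤ 𝓝 y ∧ U ∈ l := by
    intro y hy hy0
    refine ⟨𝓝[U] y, mem_closure_iff_nhdsWithin_neBot.1 ?_, nhdsWithin_le_nhds, self_mem_nhdsWithin⟩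
    refine mem_closure_of_tendsto (f := fun t : ℝ => y + t * I) (b := 𝓝[>] 0) ?_ ?_
    · have : Tendsto (fun t : ℝ => y + t * I) (𝓝 0) (𝓝 (y + (0 : ℝ) * I)) :=
        Continuous.tendsto (by fun_prop) 0
      simpa using this.mono_left nhdsWithin_le_nhds
    · have h1 : ∀ᶠ t : ℝ in 𝓝[>] 0, y + t * I ∈ ball (x : ℂ) r := by
        have : Tendsto (fun t : ℝ => y + t * I) (𝓝 0) (𝓝 (y + (0 : ℝ) * I)) :=
          Continuous.tendsto (by fun_prop) 0
        refine (this.mono_left nhdsWithin_le_nhds).eventually_mem (isOpen_ball.mem_nhds ?_)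
        simpa using hy
      filter_upwards [h1, self_mem_nhdsWithin] with t ht ht0
      exact ⟨ht, by simpa [hy0] using ht0⟩
  have hreal : ∀ y ∈ ball (x : ℂ) r, y.im = 0 → (g y).im = 0 := by
    intro y hy hy0
    obtain ⟨l, hl, hly, hUl⟩ := happroach y hy hy0
    have hgl' : Tendsto g l (𝓝 (g y)) := hgc.continuousAt.tendsto.mono_left hly
    have hsub : Tendsto (fun z : ℂ => z - x) l (𝓝 (y - x)) :=
      (Continuous.tendsto (by fun_prop) y).mono_left hly
    by_cases hyx : y = x
    · have h0 : Tendsto g l (𝓝 0) := by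
        rw [hyx, sub_self] at hsub
        have h1 : Tendsto (fun z : ℂ => M * ‖z - x‖) l (𝓝 0) := by
          simpa using hsub.norm.const_mul M
        refine squeeze_zero_norm' ?_ h1
        filter_upwards [hUl] with z hz
        have hzp := hne z hz
        have := hM z hz
        rw [le_div_iff₀ (by positivity)] at this
        rw [← hgq hz, norm_mul, norm_pow]
        calc ‖z - x‖ ^ 3 * ‖ω z‖ = (‖ω z‖ * ‖z - x‖ ^ 2) * ‖z - x‖ := by ring
          _ ≤ _ := by gcongr
      rw [tendsto_nhds_unique hgl' h0, zero_im]
    · have hyx' : y - x ≠ 0 := sub_ne_zero.2 hyx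
      have h1 : Tendsto (fun z => g z / (z - x) ^ 3) l (𝓝 (g y / (y - x) ^ 3)) :=
        hgl'.div (hsub.pow 3) (pow_ne_zero _ hyx')
      have h2 : Tendsto ω l (𝓝 (g y / (y - x) ^ 3)) := by
        refine h1.congr' ?_
        filter_upwards [hUl] with z hz
        have := norm_pos_iff.1 (hne z hz)
        rw [← hgq hz]
        simp only [q]
        field_simp
      have h3 : Tendsto (fun z => (ω z).im) l (𝓝 0) := by
        have h4 : Tendsto (fun z : ℂ => C * z.im / ‖z - x‖ ^ 2) l
            (𝓝 (C * y.im / ‖y - x‖ ^ 2)) :=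
          (((continuous_im.tendsto y).mono_left hly).const_mul C).div (hsub.norm.pow 2)
            (by positivity)
        rw [hy0, mul_zero, zero_div] at h4
        refine squeeze_zero' ?_ ?_ h4
        · filter_upwards [hUl] with z hz using (hm z hz.2).le
        · filter_upwards [hUl] with z hz using hC z hz.1 hz.2
      have h5 : (g y / (y - x) ^ 3).im = 0 :=
        tendsto_nhds_unique ((continuous_im.tendsto _).comp h2) h3
      have e : g y = (y - x) ^ 3 * (g y / (y - x) ^ 3) := by field_simp
      have e1 : y = (y.re : ℂ) := (conj_eq_iff_re.1 (conj_eq_iff_im.2 hy0)).symm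
      have e2 : g y / (y - x) ^ 3 = ((g y / (y - x) ^ 3).re : ℂ) :=
        (conj_eq_iff_re.1 (conj_eq_iff_im.2 h5)).symm
      rw [e, e2, e1]
      norm_cast
  obtain ⟨R, hRd, hRg, hRc⟩ := exists_schwarz_reflection hgc
    (fun z hz => ((hqd z hz).differentiableAt.congr_of_eventuallyEq
      ((hgq.symm.eventuallyEq_of_mem (hUo.mem_nhds hz)))).differentiableWithinAt) hreal
  have hRa : ∀ z ∈ ball (x : ℂ) r, AnalyticAt ℂ R z := fun z hz =>
    hRd.analyticAt (isOpen_ball.mem_nhds hz)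
  let f : ℂ → ℂ := fun z => R z / (z - x) ^ 3
  have hfa : ∀ z ∈ ball (x : ℂ) r, z ≠ x → AnalyticAt ℂ f z := fun z hz hzx =>
    (hRa z hz).div (by fun_prop) (pow_ne_zero _ (sub_ne_zero.2 hzx))
  have hfm : MeromorphicAt f x :=
    (hRa x (mem_ball_self hr)).meromorphicAt.div (by fun_prop)
  have hΩ := hfm.eqOn_compl_singleton_toMeromorphicNFAt
  refine ⟨toMeromorphicNFAt f x, fun z hz hzx => ?_, meromorphicNFAt_toMeromorphicNFAt,
    fun z hz hzi => ?_, fun z hz hzx => ?_⟩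
  · exact (hfa z hz hzx).congr (hΩ.eventuallyEq_of_mem (isOpen_compl_singleton.mem_nhds hzx))
  · have hzx : z - x ≠ 0 := norm_pos_iff.1 (hne z ⟨hz, hzi⟩)
    rw [← hΩ (sub_ne_zero.1 hzx)]
    simp only [f]
    rw [hRg z hz hzi, ← hgq ⟨hz, hzi⟩]
    simp only [q]
    field_simp
  · have hzx' : conj z ≠ x := fun h => hzx (by rw [← conj_conj z, h, conj_ofReal])
    rw [← hΩ hzx, ← hΩ hzx']
    simp [f, hRc z hz]

theorem exists_ae_le_abs_sub_of_notMem_msupp {μ : Measure ℝ} {x : ℝ} (hx : x ∉ msupp μ) :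
    ∃ r : ℝ, 0 < r ∧ ∀ᵐ t ∂μ, r ≤ |x - t| := by
  simp only [msupp, Set.mem_ofPred_eq, not_forall, not_lt, nonpos_iff_eq_zero] at hx
  obtain ⟨r, hr, h⟩ := hx
  refine ⟨r, hr, ?_⟩
  rw [ae_iff]
  convert h using 2
  ext t
  simp [Real.dist_eq, abs_sub_comm]

theorem half_le_norm_sub {x t r : ℝ} (ht : r ≤ |x - t|) {z : ℂ} (hz : z ∈ ball (x : ℂ) (r / 2)) :
    r / 2 ≤ ‖z - t‖ := by
  rw [mem_ball, Complex.dist_eq] at hz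
  have h1 : ‖(x : ℂ) - t‖ = |x - t| := by rw [← ofReal_sub, norm_real, Real.norm_eq_abs]
  have h2 : ‖(x : ℂ) - t‖ ≤ ‖z - x‖ + ‖z - t‖ := by
    calc ‖(x : ℂ) - t‖ = ‖(z - t) - (z - x)‖ := by congr 1; ring
      _ ≤ ‖z - t‖ + ‖z - x‖ := norm_sub_le _ _
      _ = _ := add_comm _ _
  linarith

/-- Cauchy-type integrals are continuous at real points with a neighbourhood of measure zero. -/
theorem continuousAt_integral_mul_inv_sub {μ : Measure ℝ} [IsFiniteMeasure μ] {x r M : ℝ}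
    (hr : 0 < r) (hx : ∀ᵐ t ∂μ, r ≤ |x - t|) {f : ℝ → ℂ} (hf : Measurable f)
    (hM : ∀ᵐ t ∂μ, ‖f t‖ ≤ M) :
    ContinuousAt (fun z : ℂ => ∫ t, f t * (z - (t : ℂ))⁻¹ ∂μ) (x : ℂ) := by
  refine continuousAt_of_dominated (bound := fun _ => M * (r / 2)⁻¹) ?_ ?_
    (integrable_const _) ?_
  · exact Eventually.of_forall fun z => by
      have : Measurable fun t : ℝ => f t * (z - (t : ℂ))⁻¹ := by fun_prop
      exact this.aestronglyMeasurable
  · filter_upwards [ball_mem_nhds (x : ℂ) (half_pos hr)] with z hz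
    filter_upwards [hx, hM] with t ht hMt
    rw [norm_mul, norm_inv]
    have := half_le_norm_sub ht hz
    have := (norm_nonneg _).trans hMt
    gcongr
  · filter_upwards [hx] with t ht
    have : (x : ℂ) - t ≠ 0 := by
      rw [← ofReal_sub]
      intro h
      rw [ofReal_eq_zero.1 h, abs_zero] at ht
      linarith
    exact continuousAt_const.mul ((continuousAt_id.sub continuousAt_const).inv₀ this)

theorem continuousAt_cauchyT {μ : Measure ℝ} [IsFiniteMeasure μ] {x r : ℝ}
    (hr : 0 < r) (hx : ∀ᵐ t ∂μ, r ≤ |x - t|) : ContinuousAt (cauchyT μ) (x : ℂ) := by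
  have := continuousAt_integral_mul_inv_sub (M := 1) hr hx (f := fun _ => 1) measurable_const
    (by simp)
  simp only [one_mul] at this
  exact this

/-- Off the support, zeros of the Cauchy transform on the real line are at most simple. -/
theorem exists_le_norm_cauchyT {μ : Measure ℝ} [IsProbabilityMeasure μ] {x r : ℝ}
    (hr : 0 < r) (hx : ∀ᵐ t ∂μ, r ≤ |x - t|) :
    ∃ c : ℝ, 0 < c ∧ ∀ᶠ z : ℂ in 𝓝 (x : ℂ), c * ‖z - x‖ ≤ ‖cauchyT μ z‖ := by
  by_cases h0 : cauchyT μ x = 0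
  · let K : ℂ → ℂ := fun z => ∫ t : ℝ, ((x : ℂ) - t)⁻¹ * (z - (t : ℂ))⁻¹ ∂μ
    have hbd : ∀ᵐ t : ℝ ∂μ, ‖((x : ℂ) - t)⁻¹‖ ≤ r⁻¹ := by
      filter_upwards [hx] with t ht
      rw [norm_inv, ← ofReal_sub, norm_real, Real.norm_eq_abs]
      gcongr
    have hKc : ContinuousAt K (x : ℂ) :=
      continuousAt_integral_mul_inv_sub hr hx (f := fun t => ((x : ℂ) - t)⁻¹) (by fun_prop) hbd
    have hKx : K x ≠ 0 := by
      have e : K x = ((∫ t, ((x - t)⁻¹) ^ 2 ∂μ : ℝ) : ℂ) := by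
        rw [← integral_complex_ofReal]
        refine integral_congr_ae (Eventually.of_forall fun t => ?_)
        simp only
        push_cast
        ring
      rw [e, ofReal_ne_zero]
      refine ne_of_gt ((integral_pos_iff_support_of_nonneg (fun t => sq_nonneg _) ?_).2 ?_)
      · have hmeas : Measurable fun t : ℝ => ((x - t)⁻¹) ^ 2 := by fun_prop
        refine Integrable.of_bound (C := (r⁻¹) ^ 2) hmeas.aestronglyMeasurable ?_
        filter_upwards [hx] with t ht
        rw [norm_pow, norm_inv, Real.norm_eq_abs]
        gcongr
      · have : Function.support (fun t : ℝ => ((x - t)⁻¹) ^ 2) =ᵐ[μ] Set.univ := by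
          refine eventuallyEq_univ.2 ?_
          filter_upwards [hx] with t ht
          have : x - t ≠ 0 := fun h => by rw [h, abs_zero] at ht; linarith
          simpa using this
        rw [measure_congr this]
        simp
    refine ⟨‖K x‖ / 2, by positivity, ?_⟩
    have h1 : ∀ᶠ z in 𝓝 (x : ℂ), ‖K x‖ / 2 < ‖K z‖ :=
      hKc.norm.eventually_const_lt (half_lt_self (norm_pos_iff.2 hKx))
    filter_upwards [h1, ball_mem_nhds (x : ℂ) (half_pos hr)] with z hz hzb
    have e : cauchyT μ z = -(z - x) * K z := by
      have hint : ∀ w ∈ ball (x : ℂ) (r / 2), Integrable (fun t : ℝ => (w - (t : ℂ))⁻¹) μ := by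
        intro w hw
        have hmeas : Measurable fun t : ℝ => (w - (t : ℂ))⁻¹ := by fun_prop
        refine Integrable.of_bound (C := (r / 2)⁻¹) hmeas.aestronglyMeasurable ?_
        filter_upwards [hx] with t ht
        have := half_le_norm_sub ht hw
        rw [norm_inv]
        gcongr
      calc cauchyT μ z = cauchyT μ z - cauchyT μ x := by rw [h0, sub_zero]
        _ = ∫ t : ℝ, ((z - (t : ℂ))⁻¹ - ((x : ℂ) - t)⁻¹) ∂μ :=
            (integral_sub (hint z hzb) (hint x (mem_ball_self (half_pos hr)))).symm
        _ = ∫ t : ℝ, -(z - x) * (((x : ℂ) - t)⁻¹ * (z - (t : ℂ))⁻¹) ∂μ := by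
            refine integral_congr_ae ?_
            filter_upwards [hx] with t ht
            have hz' := half_le_norm_sub ht hzb
            have hx' := half_le_norm_sub ht (mem_ball_self (half_pos hr))
            have hz0 : z - t ≠ 0 := norm_pos_iff.1 (by linarith)
            have hx0 : (x : ℂ) - t ≠ 0 := norm_pos_iff.1 (by linarith)
            field_simp
            ring
        _ = _ := integral_const_mul _ _
    rw [e, norm_mul, norm_neg, mul_comm]
    gcongr
  · have hc := continuousAt_cauchyT hr hx
    have h1 : ∀ᶠ z in 𝓝 (x : ℂ), ‖cauchyT μ x‖ / 2 < ‖cauchyT μ z‖ :=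
      hc.norm.eventually_const_lt (half_lt_self (norm_pos_iff.2 h0))
    refine ⟨‖cauchyT μ x‖ / 2, by positivity, ?_⟩
    filter_upwards [h1, ball_mem_nhds (x : ℂ) one_pos] with z hz hz1
    rw [mem_ball, Complex.dist_eq] at hz1
    calc ‖cauchyT μ x‖ / 2 * ‖z - x‖ ≤ ‖cauchyT μ x‖ / 2 * 1 := by gcongr
      _ ≤ _ := by linarith

section UpperHalfPlane

variable {μ : Measure ℝ} [IsProbabilityMeasure μ] {z : ℂ}

theorem im_le_norm_sub_ofReal (t : ℝ) : z.im ≤ ‖z - t‖ := by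
  simpa using (le_abs_self _).trans (abs_im_le_norm (z - t))

theorem integrable_inv_sub (hz : 0 < z.im) : Integrable (fun t : ℝ => (z - (t : ℂ))⁻¹) μ := by
  have hmeas : Measurable fun t : ℝ => (z - (t : ℂ))⁻¹ := by fun_prop
  refine Integrable.of_bound (C := z.im⁻¹) hmeas.aestronglyMeasurable
    (Eventually.of_forall fun t => ?_)
  have := im_le_norm_sub_ofReal (z := z) t
  rw [norm_inv]
  gcongr

theorem integrable_normSq_inv (hz : 0 < z.im) :
    Integrable (fun t : ℝ => ‖(z - (t : ℂ))⁻¹‖ ^ 2) μ := by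
  have hmeas : Measurable fun t : ℝ => ‖(z - (t : ℂ))⁻¹‖ ^ 2 := by fun_prop
  refine Integrable.of_bound (C := z.im⁻¹ ^ 2) hmeas.aestronglyMeasurable
    (Eventually.of_forall fun t => ?_)
  have := im_le_norm_sub_ofReal (z := z) t
  rw [norm_pow, norm_norm, norm_inv]
  gcongr

theorem im_cauchyT (hz : 0 < z.im) :
    (cauchyT μ z).im = -(z.im * ∫ t : ℝ, ‖(z - (t : ℂ))⁻¹‖ ^ 2 ∂μ) := by
  rw [cauchyT, ← RCLike.im_eq_complex_im, ← integral_im (integrable_inv_sub hz),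
    ← integral_const_mul, ← integral_neg]
  refine integral_congr_ae (Eventually.of_forall fun t => ?_)
  simp [normSq_eq_norm_sq, div_eq_mul_inv]

theorem integral_normSq_inv_pos (hz : 0 < z.im) : 0 < ∫ t : ℝ, ‖(z - (t : ℂ))⁻¹‖ ^ 2 ∂μ := by
  refine (integral_pos_iff_support_of_nonneg (fun t => sq_nonneg _) (integrable_normSq_inv hz)).2 ?_
  have : Function.support (fun t : ℝ => ‖(z - (t : ℂ))⁻¹‖ ^ 2) = Set.univ := by
    refine Set.eq_univ_of_forall fun t => ?_
    have := im_le_norm_sub_ofReal (z := z) t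
    have h : z - t ≠ 0 := norm_pos_iff.1 (by linarith)
    simpa using h
  rw [this]
  simp

theorem cauchyT_ne_zero (hz : 0 < z.im) : cauchyT μ z ≠ 0 := fun h => by
  have := im_cauchyT (μ := μ) hz
  rw [h, zero_im] at this
  have := mul_pos hz (integral_normSq_inv_pos (μ := μ) hz)
  linarith

theorem im_inv_cauchyT (hz : 0 < z.im) :
    ((cauchyT μ z)⁻¹).im = z.im * (∫ t : ℝ, ‖(z - (t : ℂ))⁻¹‖ ^ 2 ∂μ) / ‖cauchyT μ z‖ ^ 2 := by
  rw [inv_im, im_cauchyT hz, neg_neg, normSq_eq_norm_sq]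

/-- The reciprocal Cauchy transform increases imaginary parts. -/
theorem im_le_im_inv_cauchyT (hz : 0 < z.im) : z.im ≤ ((cauchyT μ z)⁻¹).im := by
  have h0 : 0 < ‖cauchyT μ z‖ := norm_pos_iff.2 (cauchyT_ne_zero hz)
  rw [im_inv_cauchyT hz, le_div_iff₀ (by positivity)]
  refine mul_le_mul_of_nonneg_left ?_ hz.le
  have h1 : ‖cauchyT μ z‖ ≤ ∫ t : ℝ, ‖(z - (t : ℂ))⁻¹‖ ∂μ := norm_integral_le_integral_norm _
  set f : ℝ → ℝ := fun t => ‖(z - (t : ℂ))⁻¹‖ with hf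
  have hfi : Integrable f μ := (integrable_inv_sub hz).norm
  have hf2 : Integrable (fun t => f t ^ 2) μ := integrable_normSq_inv hz
  set m := ∫ t, f t ∂μ with hm
  have h2 : 0 ≤ ∫ t, (f t - m) ^ 2 ∂μ := integral_nonneg fun t => sq_nonneg _
  have h3 : ∫ t, (f t - m) ^ 2 ∂μ = (∫ t, f t ^ 2 ∂μ) - m ^ 2 := by
    have e : ∀ t, (f t - m) ^ 2 = f t ^ 2 - 2 * m * f t + m ^ 2 := fun t => by ring
    simp_rw [e]
    have hfm : Integrable (fun t => 2 * m * f t) μ := hfi.const_mul _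
    have hsub : Integrable (fun t => f t ^ 2 - 2 * m * f t) μ := hf2.sub hfm
    rw [integral_add hsub (integrable_const _), integral_sub hf2 hfm, integral_const_mul, ← hm]
    simp
    ring
  have h4 : ‖cauchyT μ z‖ ^ 2 ≤ m ^ 2 := by gcongr
  linarith

theorem integral_normSq_inv_le {x r : ℝ} (hr : 0 < r) (hx : ∀ᵐ t ∂μ, r ≤ |x - t|)
    (hz : z ∈ ball (x : ℂ) (r / 2)) :
    ∫ t : ℝ, ‖(z - (t : ℂ))⁻¹‖ ^ 2 ∂μ ≤ ((r / 2)⁻¹) ^ 2 := by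
  have h : ∀ᵐ t : ℝ ∂μ, ‖‖(z - (t : ℂ))⁻¹‖ ^ 2‖ ≤ ((r / 2)⁻¹) ^ 2 := by
    filter_upwards [hx] with t ht
    have := half_le_norm_sub ht hz
    rw [norm_pow, norm_norm, norm_inv]
    gcongr
  simpa using (le_abs_self _).trans (norm_integral_le_of_norm_le_const h)

end UpperHalfPlane

/-- A real point near which `∫ |w - t|⁻² dμ(t)` stays bounded lies outside the support. -/
theorem notMem_msupp_of_integral_le {μ : Measure ℝ} [IsProbabilityMeasure μ] {u C : ℝ}
    (h : ∀ᶠ w in 𝓝 (u : ℂ), 0 < w.im → ∫ t : ℝ, ‖(w - (t : ℂ))⁻¹‖ ^ 2 ∂μ ≤ C) :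
    u ∉ msupp μ := by
  obtain ⟨r, hr, hball⟩ := Metric.eventually_nhds_iff_ball.1 h
  have key : ∀ y ∈ ball u (r / 2), ∀ η : ℝ, 0 < η → η < r / 2 →
      μ.real (closedBall y η) ≤ 2 * η ^ 2 * C := by
    intro y hy η hη hηr
    set w : ℂ := y + η * I with hw
    have hwim : w.im = η := by simp [hw]
    have hwb : w ∈ ball (u : ℂ) r := by
      rw [mem_ball, Real.dist_eq] at hy
      rw [mem_ball, Complex.dist_eq]
      calc ‖w - u‖ = ‖((y - u : ℝ) : ℂ) + η * I‖ := by rw [hw]; push_cast; congr 1; ring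
        _ ≤ |y - u| + |η| := by
            refine (norm_add_le _ _).trans (le_of_eq ?_)
            simp [-ofReal_sub]
        _ < r := by rw [abs_of_pos hη]; linarith
    have h1 := hball w hwb (by rw [hwim]; exact hη)
    have h2 : (2 * η ^ 2)⁻¹ * μ.real (closedBall y η) ≤ ∫ t : ℝ, ‖(w - (t : ℂ))⁻¹‖ ^ 2 ∂μ := by
      have hi := integrable_normSq_inv (μ := μ) (z := w) (by rw [hwim]; exact hη)
      calc (2 * η ^ 2)⁻¹ * μ.real (closedBall y η)
          = ∫ _t in closedBall y η, (2 * η ^ 2)⁻¹ ∂μ := by simp [mul_comm]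
        _ ≤ ∫ t in closedBall y η, ‖(w - (t : ℂ))⁻¹‖ ^ 2 ∂μ := by
            refine setIntegral_mono_on (integrable_const _) hi.integrableOn
              measurableSet_closedBall fun t ht => ?_
            rw [mem_closedBall, Real.dist_eq, abs_le] at ht
            rw [norm_inv, inv_pow, ← normSq_eq_norm_sq, normSq_apply]
            have e1 : (w - t).re = y - t := by simp [hw]
            have e2 : (w - t).im = η := by simp [hw]
            rw [e1, e2]
            refine inv_anti₀ (add_pos_of_nonneg_of_pos (mul_self_nonneg _) (mul_pos hη hη)) ?_
            linarith [sq_le_sq' (a := y - t) (b := η) (by linarith) (by linarith)]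
        _ ≤ _ := setIntegral_le_integral hi (Eventually.of_forall fun t => sq_nonneg _)
    have h3 := h2.trans h1
    rw [inv_mul_le_iff₀ (by positivity)] at h3
    exact h3
  have hC : 0 ≤ C := by
    have := measureReal_nonneg.trans
      (key u (mem_ball_self (by positivity)) (r / 4) (by positivity) (by linarith))
    by_contra hc
    have h2 : 2 * (r / 4) ^ 2 * C < 0 := mul_neg_of_pos_of_neg (by positivity) (not_le.1 hc)
    linarith
  have hle : ∀ ε : NNReal, 0 < ε → μ (ball u (r / 2)) ≤ ε * volume (ball u (r / 2)) := by
    intro ε hε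
    refine ((Besicovitch.vitaliFamily μ).measure_le_of_frequently_le (ε • volume)
      Measure.AbsolutelyContinuous.rfl (ball u (r / 2)) fun y hy => ?_).trans (le_of_eq ?_)
    swap
    · rw [Measure.smul_apply, ENNReal.smul_def, smul_eq_mul]
    refine (Besicovitch.tendsto_filterAt μ y).frequently (Eventually.frequently ?_)
    have hs : ∀ᶠ η : ℝ in 𝓝[>] 0, C * η < ε := by
      have : Tendsto (fun η : ℝ => C * η) (𝓝 0) (𝓝 (C * 0)) :=
        Continuous.tendsto (by fun_prop) 0
      rw [mul_zero] at this
      exact (this.mono_left nhdsWithin_le_nhds).eventually_lt_const hε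
    have hs' : ∀ᶠ η : ℝ in 𝓝[>] 0, η < r / 2 :=
      nhdsWithin_le_nhds (eventually_lt_nhds (by positivity))
    filter_upwards [hs, hs', self_mem_nhdsWithin] with η h1 h2 h3
    have h3 : 0 < η := h3
    have h4 := key y hy η h3 h2
    rw [Measure.smul_apply, Real.volume_closedBall, ← ENNReal.ofReal_toReal (measure_ne_top μ _),
      ENNReal.smul_def, smul_eq_mul, ← ENNReal.ofReal_coe_nnreal, ← ENNReal.ofReal_mul (by simp)]
    refine ENNReal.ofReal_le_ofReal (h4.trans ?_)
    nlinarith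
  have hzero : μ (ball u (r / 2)) = 0 := by
    rw [Real.volume_ball] at hle
    by_contra hne
    have hpos : 0 < μ (ball u (r / 2)) := pos_iff_ne_zero.2 hne
    have hlim : Tendsto (fun ε : NNReal => (ε : ENNReal) * ENNReal.ofReal (2 * (r / 2)))
        (𝓝[>] 0) (𝓝 0) := by
      have : Tendsto (fun ε : NNReal => ((ε * Real.toNNReal (2 * (r / 2)) : NNReal) : ENNReal))
          (𝓝 0) (𝓝 ((0 * Real.toNNReal (2 * (r / 2)) : NNReal) : ENNReal)) :=
        ENNReal.tendsto_coe.2 (Continuous.tendsto (by fun_prop) 0)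
      simp only [zero_mul, ENNReal.coe_zero, ENNReal.coe_mul] at this
      exact this.mono_left nhdsWithin_le_nhds
    have := ge_of_tendsto hlim (by filter_upwards [self_mem_nhdsWithin] with ε hε using hle ε hε)
    exact hne (nonpos_iff_eq_zero.1 this)
  intro hu
  exact (hu (r / 2) (by positivity)).ne' hzero

/-- `F_μ(w) - w` tends to minus the mean of `μ` as `w → ∞` in the upper half-plane. -/
theorem tendsto_inv_cauchyT_sub {μ : Measure ℝ} [IsProbabilityMeasure μ] {m : ℝ}
    (hm : μ (Set.Icc (-m) m)ᶜ = 0) {α : Type*} {l : Filter α} [l.IsCountablyGenerated]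
    {w : α → ℂ} (hw : Tendsto w l (Bornology.cobounded ℂ)) (hpos : ∀ᶠ a in l, 0 < (w a).im) :
    Tendsto (fun a => (cauchyT μ (w a))⁻¹ - w a) l (𝓝 (-((∫ t, t ∂μ : ℝ) : ℂ))) := by
  have hae : ∀ᵐ t ∂μ, |t| ≤ m := by
    rw [ae_iff]
    convert hm using 2
    ext t
    simp [abs_le]
  have hinv : Tendsto (fun a => (w a)⁻¹) l (𝓝 0) := tendsto_inv₀_cobounded.comp hw
  have hbig : ∀ᶠ a in l, 2 * |m| + 1 ≤ ‖w a‖ :=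
    (tendsto_norm_cobounded_atTop.comp hw).eventually_ge_atTop _
  have hlim : ∀ f : ℝ → ℂ, Measurable f → ∀ B : ℝ, (∀ᵐ t ∂μ, ‖f t‖ ≤ B) →
      Tendsto (fun a => ∫ t, f t * (w a * (w a - t)⁻¹) ∂μ) l (𝓝 (∫ t, f t ∂μ)) := by
    intro f hf B hB
    refine tendsto_integral_filter_of_dominated_convergence (fun _ => B * 2) ?_ ?_
      (integrable_const _) ?_
    · exact Eventually.of_forall fun a => by
        have : Measurable fun t : ℝ => f t * (w a * (w a - t)⁻¹) := by fun_prop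
        exact this.aestronglyMeasurable
    · filter_upwards [hbig] with a ha
      filter_upwards [hae, hB] with t ht hBt
      have h0 := (norm_nonneg _).trans hBt
      rw [norm_mul, norm_mul, norm_inv]
      have h1 : ‖w a‖ ≤ 2 * ‖w a - t‖ := by
        have h2 : ‖w a‖ ≤ ‖w a - t‖ + ‖(t : ℂ)‖ := by
          simpa using norm_add_le (w a - t) (t : ℂ)
        rw [norm_real, Real.norm_eq_abs] at h2
        linarith [le_abs_self m]
      have h3 : 0 < ‖w a - t‖ := by linarith [abs_nonneg m]
      gcongr
      rwa [← div_eq_mul_inv, div_le_iff₀ h3]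
    · refine Eventually.of_forall fun t => ?_
      have h0 : Tendsto (fun a => 1 - t * (w a)⁻¹) l (𝓝 1) := by
        simpa using (hinv.const_mul (t : ℂ)).const_sub 1
      have h1 := (h0.inv₀ one_ne_zero).const_mul (f t)
      rw [inv_one, mul_one] at h1
      refine h1.congr' ?_
      filter_upwards [hbig] with a ha
      have h0 : w a ≠ 0 := norm_pos_iff.1 (by linarith [abs_nonneg m])
      congr 1
      rw [← inv_inv (w a * (w a - t)⁻¹), mul_inv, inv_inv, mul_sub, inv_mul_cancel₀ h0]
      ring
  have hA := hlim (fun _ => 1) measurable_const 1 (by simp)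
  have hB := hlim (fun t => (t : ℂ)) (by fun_prop) m (by simpa using hae)
  rw [integral_const, probReal_univ, one_smul] at hA
  have hq := (hB.neg).div hA one_ne_zero
  rw [div_one, integral_complex_ofReal] at hq
  refine hq.congr' ?_
  filter_upwards [hpos, hbig] with a ha hb
  have h0 : w a ≠ 0 := norm_pos_iff.1 (by linarith [abs_nonneg m])
  have hG := cauchyT_ne_zero (μ := μ) ha
  have e1 : ∫ t : ℝ, 1 * (w a * (w a - t)⁻¹) ∂μ = w a * cauchyT μ (w a) := by
    simp only [one_mul]
    exact integral_const_mul _ _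
  have e2 : ∫ t : ℝ, (t : ℂ) * (w a * (w a - t)⁻¹) ∂μ = w a * (w a * cauchyT μ (w a) - 1) := by
    have : ∀ t : ℝ, (t : ℂ) * (w a * (w a - t)⁻¹) = w a * (w a * (w a - t)⁻¹ - 1) := by
      intro t
      have := im_le_norm_sub_ofReal (z := w a) t
      have h : w a - t ≠ 0 := norm_pos_iff.1 (by linarith)
      field_simp
      ring
    simp_rw [this]
    rw [integral_const_mul, integral_sub ((integrable_inv_sub ha).const_mul _)
      (integrable_const _), integral_const_mul]
    simp [cauchyT]
  rw [Pi.div_apply, e1, e2]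
  field_simp
  ring

theorem neBot_nhdsWithin_upperHalf (x : ℝ) : (𝓝[{z : ℂ | 0 < z.im}] (x : ℂ)).NeBot := by
  rw [← mem_closure_iff_nhdsWithin_neBot, closure_setOfPred_lt_im]
  simp

theorem nhdsWithin_upperHalf_le_nhdsNE (x : ℝ) : 𝓝[{z : ℂ | 0 < z.im}] (x : ℂ) ≤ 𝓝[≠] (x : ℂ) := by
  refine nhdsWithin_mono _ fun z hz h => ?_
  have hz' : 0 < z.im := hz
  rw [Set.mem_singleton_iff.1 h, ofReal_im] at hz'
  exact lt_irrefl _ hz'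

theorem conj_mem_ball_ofReal {x r : ℝ} {z : ℂ} (hz : z ∈ ball (x : ℂ) r) :
    conj z ∈ ball (x : ℂ) r := by
  rw [mem_ball, Complex.dist_eq] at hz ⊢
  rwa [← Complex.norm_conj, map_sub, conj_conj, conj_ofReal]

/-- Analytic functions commuting with conjugation near a real point are real there. -/
theorem im_eq_zero_of_reflection {Ω : ℂ → ℂ} {x y r : ℝ} (hy : (y : ℂ) ∈ ball (x : ℂ) r)
    (hΩ : AnalyticAt ℂ Ω y)
    (href : ∀ z ∈ ball (x : ℂ) r, z ≠ x → Ω (conj z) = conj (Ω z)) : (Ω y).im = 0 := by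
  rw [← conj_eq_iff_im]
  have h1 : Tendsto (fun z => Ω (conj z)) (𝓝[≠] (y : ℂ)) (𝓝 (Ω y)) := by
    have : Tendsto (fun z : ℂ => conj z) (𝓝[≠] (y : ℂ)) (𝓝 (y : ℂ)) := by
      have h := (continuous_conj.tendsto (y : ℂ)).mono_left
        (nhdsWithin_le_nhds (s := {(y : ℂ)}ᶜ))
      rwa [conj_ofReal] at h
    exact hΩ.continuousAt.tendsto.comp this
  have h2 : Tendsto (fun z => conj (Ω z)) (𝓝[≠] (y : ℂ)) (𝓝 (conj (Ω y))) :=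
    (continuous_conj.tendsto _).comp (hΩ.continuousAt.tendsto.mono_left nhdsWithin_le_nhds)
  refine tendsto_nhds_unique (h2.congr' ?_) h1
  have hne : ∀ᶠ z : ℂ in 𝓝[≠] (y : ℂ), z ≠ x := by
    by_cases hyx : (y : ℂ) = x
    · rw [hyx]
      exact self_mem_nhdsWithin
    · exact nhdsWithin_le_nhds (isOpen_ne.mem_nhds hyx)
  filter_upwards [nhdsWithin_le_nhds (isOpen_ball.mem_nhds hy), hne] with z hz hzx
  exact (href z hz hzx).symm

/-- If `G_μ ∘ ω = G_σ` and `ω` extends analytically to a point `x` off the support of `σ`, then the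
value there is off the support of `μ`. -/
theorem re_notMem_msupp_of_analyticAt {μ σ : Measure ℝ} [IsProbabilityMeasure μ]
    [IsProbabilityMeasure σ] {ω Ω : ℂ → ℂ} {x r ε : ℝ} (hr : 0 < r) (hε : 0 < ε)
    (hx : ∀ᵐ t ∂σ, r ≤ |x - t|) (him : ∀ z : ℂ, 0 < z.im → z.im ≤ (ω z).im)
    (hG : ∀ z : ℂ, 0 < z.im → cauchyT μ (ω z) = cauchyT σ z)
    (hext : ∀ z ∈ ball (x : ℂ) ε, 0 < z.im → Ω z = ω z)
    (href : ∀ z ∈ ball (x : ℂ) ε, z ≠ x → Ω (conj z) = conj (Ω z))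
    (hΩ : AnalyticAt ℂ Ω x) : (Ω x).re ∉ msupp μ := by
  have hx0 : (Ω x).im = 0 := im_eq_zero_of_reflection (mem_ball_self hε) hΩ href
  have hxre : ((Ω x).re : ℂ) = Ω x := conj_eq_iff_re.1 (conj_eq_iff_im.2 hx0)
  have := neBot_nhdsWithin_upperHalf x
  rcases hΩ.eventually_constant_or_nhds_le_map_nhds with hc | hopen
  · have h1 : ∀ᶠ z : ℂ in 𝓝[{z : ℂ | 0 < z.im}] (x : ℂ), False := by
      filter_upwards [nhdsWithin_le_nhds hc, nhdsWithin_le_nhds (ball_mem_nhds (x : ℂ) hε),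
        self_mem_nhdsWithin] with z hz hzb hzi
      have hzi : 0 < z.im := hzi
      have h2 := him z hzi
      rw [← hext z hzb hzi, hz, hx0] at h2
      linarith
    exact h1.exists.choose_spec.elim
  refine notMem_msupp_of_integral_le (C := ((r / 2)⁻¹) ^ 2) ?_
  rw [hxre]
  have himg : Ω '' (ball (x : ℂ) ε ∩ ball (x : ℂ) (r / 2)) ∈ 𝓝 (Ω x) :=
    hopen (image_mem_map (inter_mem (ball_mem_nhds _ hε) (ball_mem_nhds _ (half_pos hr))))
  filter_upwards [himg]
  rintro _ ⟨z, ⟨hzε, hzr⟩, rfl⟩ hpos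
  have hzi : 0 < z.im := by
    rcases lt_trichotomy z.im 0 with h | h | h
    · have hcz : 0 < (conj z).im := by simpa using h
      have hzx : z ≠ x := by
        rintro rfl
        simp at h
      have h1 := him _ hcz
      rw [← hext _ (conj_mem_ball_ofReal hzε) hcz, href z hzε hzx, conj_im, conj_im] at h1
      linarith
    · have hzre : (z.re : ℂ) = z := conj_eq_iff_re.1 (conj_eq_iff_im.2 h)
      by_cases hzx : z = x
      · rw [hzx, hx0] at hpos
        exact absurd hpos (lt_irrefl _)
      · have h1 := href z hzε hzx
        rw [conj_eq_iff_im.2 h, eq_comm, conj_eq_iff_im] at h1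
        linarith
    · exact h
  rw [hext z hzε hzi] at hpos ⊢
  have h1 := congrArg Complex.im (hG z hzi)
  rw [im_cauchyT hpos, im_cauchyT hzi, neg_inj] at h1
  refine le_trans ?_ (integral_normSq_inv_le (μ := σ) hr hx hzr)
  have h2 := integral_normSq_inv_pos (μ := σ) hzi
  have h3 := him z hzi
  refine le_of_mul_le_mul_left ?_ hpos
  rw [h1]
  gcongr

/-- If one subordination function has a pole at `x`, the other one is analytic there. -/
theorem analyticAt_of_not_analyticAt {μ : Measure ℝ} [IsProbabilityMeasure μ] {m : ℝ}
    (hm : μ (Set.Icc (-m) m)ᶜ = 0) {ω₁ ω₂ Ω₁ Ω₂ : ℂ → ℂ} {x ε : ℝ} (hε : 0 < ε)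
    (hpos : ∀ z : ℂ, 0 < z.im → 0 < (ω₁ z).im)
    (hsub : ∀ z : ℂ, 0 < z.im → ω₁ z + ω₂ z - z = (cauchyT μ (ω₁ z))⁻¹)
    (hext₁ : ∀ z ∈ ball (x : ℂ) ε, 0 < z.im → Ω₁ z = ω₁ z)
    (hext₂ : ∀ z ∈ ball (x : ℂ) ε, 0 < z.im → Ω₂ z = ω₂ z)
    (hΩ₁ : MeromorphicNFAt Ω₁ (x : ℂ)) (hΩ₂ : MeromorphicNFAt Ω₂ (x : ℂ))
    (h : ¬ AnalyticAt ℂ Ω₁ x) :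
    AnalyticAt ℂ Ω₂ x ∧ Ω₂ x = (x : ℂ) - ((∫ t, t ∂μ : ℝ) : ℂ) := by
  have := neBot_nhdsWithin_upperHalf x
  have hU : ∀ᶠ z : ℂ in 𝓝[{z : ℂ | 0 < z.im}] (x : ℂ), z ∈ ball (x : ℂ) ε ∧ 0 < z.im :=
    (eventually_mem_set.2 (nhdsWithin_le_nhds (ball_mem_nhds _ hε))).and self_mem_nhdsWithin
  have hcob : Tendsto ω₁ (𝓝[{z : ℂ | 0 < z.im}] (x : ℂ)) (Bornology.cobounded ℂ) := by
    have h1 : meromorphicOrderAt Ω₁ x < 0 :=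
      not_le.1 fun h' => h (hΩ₁.meromorphicOrderAt_nonneg_iff_analyticAt.1 h')
    refine ((tendsto_cobounded_of_meromorphicOrderAt_neg h1).mono_left
      (nhdsWithin_upperHalf_le_nhdsNE x)).congr' ?_
    filter_upwards [hU] with z hz using hext₁ z hz.1 hz.2
  have hlim : Tendsto Ω₂ (𝓝[{z : ℂ | 0 < z.im}] (x : ℂ))
      (𝓝 ((x : ℂ) - ((∫ t, t ∂μ : ℝ) : ℂ))) := by
    have h1 := tendsto_inv_cauchyT_sub hm hcob (hU.mono fun z hz => hpos z hz.2)
    have h2 : Tendsto (fun z : ℂ => z) (𝓝[{z : ℂ | 0 < z.im}] (x : ℂ)) (𝓝 (x : ℂ)) :=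
      nhdsWithin_le_nhds
    refine (sub_eq_add_neg (x : ℂ) _ ▸ h2.add h1).congr' ?_
    filter_upwards [hU] with z hz
    rw [hext₂ z hz.1 hz.2, ← hsub z hz.2]
    ring
  have han : AnalyticAt ℂ Ω₂ x := by
    by_contra h'
    have h1 : meromorphicOrderAt Ω₂ x < 0 :=
      not_le.1 fun h'' => h' (hΩ₂.meromorphicOrderAt_nonneg_iff_analyticAt.1 h'')
    have h2 := (tendsto_cobounded_of_meromorphicOrderAt_neg h1).mono_left
      (nhdsWithin_upperHalf_le_nhdsNE x)
    exact hlim.not_tendsto (Metric.disjoint_nhds_cobounded _) h2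
  exact ⟨han, tendsto_nhds_unique (han.continuousAt.tendsto.mono_left nhdsWithin_le_nhds) hlim⟩

/-- The subordination relation passes to real boundary points. -/
theorem eq_inv_cauchyT_of_analyticAt {μ : Measure ℝ} [IsProbabilityMeasure μ]
    {ω₁ ω₂ Ω₁ Ω₂ : ℂ → ℂ} {x ε : ℝ} (hε : 0 < ε)
    (hpos : ∀ z : ℂ, 0 < z.im → 0 < (ω₁ z).im)
    (hsub : ∀ z : ℂ, 0 < z.im → ω₁ z + ω₂ z - z = (cauchyT μ (ω₁ z))⁻¹)
    (hext₁ : ∀ z ∈ ball (x : ℂ) ε, 0 < z.im → Ω₁ z = ω₁ z)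
    (hext₂ : ∀ z ∈ ball (x : ℂ) ε, 0 < z.im → Ω₂ z = ω₂ z)
    (hΩ₁ : AnalyticAt ℂ Ω₁ x) (hΩ₂ : AnalyticAt ℂ Ω₂ x)
    (him : (Ω₁ x).im = 0) (hsupp : (Ω₁ x).re ∉ msupp μ) :
    Ω₂ x = (cauchyT μ (Ω₁ x))⁻¹ - Ω₁ x + x := by
  have := neBot_nhdsWithin_upperHalf x
  obtain ⟨r, hr, hrae⟩ := exists_ae_le_abs_sub_of_notMem_msupp hsupp
  have hG := continuousAt_cauchyT hr hrae
  rw [conj_eq_iff_re.1 (conj_eq_iff_im.2 him)] at hG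
  have h1 : ContinuousAt (fun z => cauchyT μ (Ω₁ z) * (Ω₁ z + Ω₂ z - z)) (x : ℂ) :=
    (ContinuousAt.comp (f := Ω₁) hG hΩ₁.continuousAt).mul
      ((hΩ₁.continuousAt.add hΩ₂.continuousAt).sub continuousAt_id)
  have h2 : cauchyT μ (Ω₁ x) * (Ω₁ x + Ω₂ x - x) = 1 := by
    refine tendsto_nhds_unique (h1.tendsto.mono_left
      (nhdsWithin_le_nhds (s := {z : ℂ | 0 < z.im}))) (tendsto_const_nhds.congr' ?_)
    filter_upwards [nhdsWithin_le_nhds (ball_mem_nhds (x : ℂ) hε), self_mem_nhdsWithin] with z hz hzi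
    rw [hext₁ z hz hzi, hext₂ z hz hzi, hsub z hzi,
      mul_inv_cancel₀ (cauchyT_ne_zero (hpos z hzi))]
  rw [← eq_inv_of_mul_eq_one_right h2]
  ring

end

open Complex in
/-- boundary behaviour of the additive subordination functions outside the support
of `σ = μ ⊞ ν`: they continue meromorphically with values in `ℝ ∪ {∞}` near any
`x ∉ supp(σ)`, the subordination relations persist, the values avoid the supports, and the pole
cases are described explicitly.  (A pole of the meromorphic continuation encodes the value `∞`.) -/
theorem stmt15 (μ ν : Measure ℝ) [IsProbabilityMeasure μ] [IsProbabilityMeasure ν]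
    (hμc : ∃ m : ℝ, μ (Set.Icc (-m) m)ᶜ = 0) (hνc : ∃ m : ℝ, ν (Set.Icc (-m) m)ᶜ = 0)
    (hμd : ∀ c : ℝ, μ ≠ Measure.dirac c) (hνd : ∀ c : ℝ, ν ≠ Measure.dirac c)
    (ω₁ ω₂ : ℂ → ℂ)
    (hω₁a : DifferentiableOn ℂ ω₁ {z : ℂ | 0 < z.im})
    (hω₂a : DifferentiableOn ℂ ω₂ {z : ℂ | 0 < z.im})
    (hω₁m : ∀ z : ℂ, 0 < z.im → 0 < (ω₁ z).im)
    (hω₂m : ∀ z : ℂ, 0 < z.im → 0 < (ω₂ z).im)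
    (hω₁l : Tendsto (fun y : ℝ => ω₁ (y * Complex.I) / (y * Complex.I)) atTop (nhds 1))
    (hω₂l : Tendsto (fun y : ℝ => ω₂ (y * Complex.I) / (y * Complex.I)) atTop (nhds 1))
    (hsub : ∀ z : ℂ, 0 < z.im →
      ω₁ z + ω₂ z - z = (cauchyT μ (ω₁ z))⁻¹ ∧ ω₁ z + ω₂ z - z = (cauchyT ν (ω₂ z))⁻¹)
    (σ : Measure ℝ) [IsProbabilityMeasure σ]
    (hσ : ∀ z : ℂ, 0 < z.im → cauchyT σ z = (ω₁ z + ω₂ z - z)⁻¹) :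
    ∀ x : ℝ, x ∉ msupp σ →
      ∃ ε : ℝ, 0 < ε ∧ ∃ Ω₁ Ω₂ : ℂ → ℂ,
        MeromorphicOn Ω₁ (Metric.ball (x : ℂ) ε) ∧
        MeromorphicOn Ω₂ (Metric.ball (x : ℂ) ε) ∧
        (∀ z ∈ Metric.ball (x : ℂ) ε, 0 < z.im → Ω₁ z = ω₁ z ∧ Ω₂ z = ω₂ z) ∧
        (∀ y : ℝ, |y - x| < ε →
          (AnalyticAt ℂ Ω₁ (y : ℂ) → (Ω₁ (y : ℂ)).im = 0) ∧
          (AnalyticAt ℂ Ω₂ (y : ℂ) → (Ω₂ (y : ℂ)).im = 0)) ∧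
        ((AnalyticAt ℂ Ω₁ (x : ℂ) ∧ AnalyticAt ℂ Ω₂ (x : ℂ) ∧
            Ω₁ (x : ℂ) = (cauchyT ν (Ω₂ (x : ℂ)))⁻¹ - Ω₂ (x : ℂ) + (x : ℂ) ∧
            Ω₂ (x : ℂ) = (cauchyT μ (Ω₁ (x : ℂ)))⁻¹ - Ω₁ (x : ℂ) + (x : ℂ) ∧
            (Ω₁ (x : ℂ)).re ∉ msupp μ ∧ (Ω₂ (x : ℂ)).re ∉ msupp ν) ∨
         (¬ AnalyticAt ℂ Ω₁ (x : ℂ) ∧ AnalyticAt ℂ Ω₂ (x : ℂ) ∧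
            Ω₂ (x : ℂ) = (x : ℂ) - ((∫ t, t ∂μ : ℝ) : ℂ) ∧
            (Ω₂ (x : ℂ)).im = 0 ∧ (Ω₂ (x : ℂ)).re ∉ msupp ν) ∨
         (¬ AnalyticAt ℂ Ω₂ (x : ℂ) ∧ AnalyticAt ℂ Ω₁ (x : ℂ) ∧
            Ω₁ (x : ℂ) = (x : ℂ) - ((∫ t, t ∂ν : ℝ) : ℂ) ∧
            (Ω₁ (x : ℂ)).im = 0 ∧ (Ω₁ (x : ℂ)).re ∉ msupp μ)) := by
  intro x hx
  obtain ⟨m₁, hm₁⟩ := hμc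
  obtain ⟨m₂, hm₂⟩ := hνc
  obtain ⟨r, hr, hrae⟩ := exists_ae_le_abs_sub_of_notMem_msupp hx
  have him₂ : ∀ z : ℂ, 0 < z.im → z.im ≤ (ω₂ z).im := fun z hz => by
    have h := im_le_im_inv_cauchyT (μ := μ) (hω₁m z hz)
    rw [← (hsub z hz).1, sub_im, add_im] at h
    linarith
  have him₁ : ∀ z : ℂ, 0 < z.im → z.im ≤ (ω₁ z).im := fun z hz => by
    have h := im_le_im_inv_cauchyT (μ := ν) (hω₂m z hz)
    rw [← (hsub z hz).2, sub_im, add_im] at h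
    linarith
  have hF : ∀ z : ℂ, 0 < z.im → ((cauchyT σ z)⁻¹).im = (ω₁ z).im + (ω₂ z).im - z.im :=
    fun z hz => by rw [hσ z hz, inv_inv, sub_im, add_im]
  obtain ⟨c, hc, hcev⟩ := exists_le_norm_cauchyT hr hrae
  obtain ⟨ε, hε, hεball⟩ := Metric.eventually_nhds_iff_ball.1
    (hcev.and (ball_mem_nhds (x : ℂ) (half_pos hr)))
  have hbound : ∀ z ∈ ball (x : ℂ) ε, 0 < z.im →
      ((cauchyT σ z)⁻¹).im ≤ ((r / 2)⁻¹ ^ 2 / c ^ 2) * z.im / ‖z - x‖ ^ 2 := by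
    intro z hz hzi
    obtain ⟨h1, h2⟩ := hεball z hz
    have hne : 0 < ‖z - x‖ := by
      refine norm_pos_iff.2 fun h => ?_
      rw [sub_eq_zero.1 h, ofReal_im] at hzi
      exact lt_irrefl _ hzi
    have h3 := integral_normSq_inv_le (μ := σ) hr hrae h2
    rw [im_inv_cauchyT hzi]
    calc z.im * (∫ t : ℝ, ‖(z - (t : ℂ))⁻¹‖ ^ 2 ∂σ) / ‖cauchyT σ z‖ ^ 2
        ≤ z.im * (r / 2)⁻¹ ^ 2 / (c * ‖z - x‖) ^ 2 := by gcongr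
      _ = _ := by field_simp
  obtain ⟨Ω₁, han₁, hnf₁, hext₁, href₁⟩ := exists_meromorphic_extension hω₁a hω₁m hε
    fun z hz hzi => le_trans (by linarith [hF z hzi, him₂ z hzi]) (hbound z hz hzi)
  obtain ⟨Ω₂, han₂, hnf₂, hext₂, href₂⟩ := exists_meromorphic_extension hω₂a hω₂m hε
    fun z hz hzi => le_trans (by linarith [hF z hzi, him₁ z hzi]) (hbound z hz hzi)
  have hG₁ : ∀ z : ℂ, 0 < z.im → cauchyT μ (ω₁ z) = cauchyT σ z := fun z hz => by
    rw [hσ z hz, (hsub z hz).1, inv_inv]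
  have hG₂ : ∀ z : ℂ, 0 < z.im → cauchyT ν (ω₂ z) = cauchyT σ z := fun z hz => by
    rw [hσ z hz, (hsub z hz).2, inv_inv]
  have hsub₁ := fun z hz => (hsub z hz).1
  have hsub₂ : ∀ z : ℂ, 0 < z.im → ω₂ z + ω₁ z - z = (cauchyT ν (ω₂ z))⁻¹ := fun z hz => by
    rw [add_comm]
    exact (hsub z hz).2
  have hreal₁ := fun h => im_eq_zero_of_reflection (mem_ball_self hε) h href₁
  have hreal₂ := fun h => im_eq_zero_of_reflection (mem_ball_self hε) h href₂
  have hsupp₁ := re_notMem_msupp_of_analyticAt hr hε hrae him₁ hG₁ hext₁ href₁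
  have hsupp₂ := re_notMem_msupp_of_analyticAt hr hε hrae him₂ hG₂ hext₂ href₂
  refine ⟨ε, hε, Ω₁, Ω₂, fun z hz => ?_, fun z hz => ?_,
    fun z hz hzi => ⟨hext₁ z hz hzi, hext₂ z hz hzi⟩, fun y hy => ?_, ?_⟩
  · by_cases hzx : z = x
    · exact hzx ▸ hnf₁.meromorphicAt
    · exact (han₁ z hz hzx).meromorphicAt
  · by_cases hzx : z = x
    · exact hzx ▸ hnf₂.meromorphicAt
    · exact (han₂ z hz hzx).meromorphicAt
  · have hyb : (y : ℂ) ∈ ball (x : ℂ) ε := by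
      rwa [mem_ball, Complex.dist_eq, ← ofReal_sub, norm_real]
    exact ⟨fun h => im_eq_zero_of_reflection hyb h href₁,
      fun h => im_eq_zero_of_reflection hyb h href₂⟩
  · by_cases h₁ : AnalyticAt ℂ Ω₁ x
    · by_cases h₂ : AnalyticAt ℂ Ω₂ x
      · exact Or.inl ⟨h₁, h₂,
          eq_inv_cauchyT_of_analyticAt hε hω₂m hsub₂ hext₂ hext₁ h₂ h₁ (hreal₂ h₂) (hsupp₂ h₂),
          eq_inv_cauchyT_of_analyticAt hε hω₁m hsub₁ hext₁ hext₂ h₁ h₂ (hreal₁ h₁) (hsupp₁ h₁),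
          hsupp₁ h₁, hsupp₂ h₂⟩
      · obtain ⟨-, hval⟩ := analyticAt_of_not_analyticAt hm₂ hε hω₂m hsub₂ hext₂ hext₁ hnf₂ hnf₁ h₂
        exact Or.inr (Or.inr ⟨h₂, h₁, hval, hreal₁ h₁, hsupp₁ h₁⟩)
    · obtain ⟨h₂, hval⟩ := analyticAt_of_not_analyticAt hm₁ hε hω₁m hsub₁ hext₁ hext₂ hnf₁ hnf₂ h₁
      exact Or.inr (Or.inl ⟨h₁, h₂, hval, hreal₂ h₂, hsupp₂ h₂⟩)
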